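/- arXiv:1703.08039 — 5 statements merged into one kernel-verified Lean document; each statement's English description precedes it below -/
import Mathlib

section
/- If n > 2 is an integer and 2n is a G number, then p1(n) > n - √(2n - 1). -/
/-- `g x m = x + 2m - ((x - m) mod 2m)`. -/
def g (x m : ℕ) : ℕ := x + 2 * m - (x - m) % (2 * m)

/-- `p1 n` is the maximum of the smallest prime factor of `g ((n-1)^2) p`
taken over all odd primes `p ≤ n`. -/
def p1 (n : ℕ) : ℕ :=
  ((Finset.range (n + 1)).filter (fun p => p.Prime ∧ Odd p)).sup
    (fun p => Nat.minFac (g ((n - 1) ^ 2) p))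

/-- The even number `2n` is a G number if `g ((n-1)^2) (p1 n) = p1 n * (2n - p1 n)`. -/
def IsGNumber (n : ℕ) : Prop :=
  g ((n - 1) ^ 2) (p1 n) = p1 n * (2 * n - p1 n)

theorem stmt_3 (n : ℕ) (hn : 2 < n) (hG : IsGNumber n) :
    (p1 n : ℝ) > (n : ℝ) - Real.sqrt (2 * n - 1) := by
  have hpos : 0 < p1 n := by
    have h3 : 3 ∈ (Finset.range (n + 1)).filter (fun p => p.Prime ∧ Odd p) := by
      simp only [Finset.mem_filter, Finset.mem_range]
      exact ⟨by omega, Nat.prime_three, by decide⟩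
    have h := Finset.le_sup (f := fun p => Nat.minFac (g ((n - 1) ^ 2) p)) h3
    exact lt_of_lt_of_le (Nat.minFac_pos _) h
  unfold IsGNumber at hG
  generalize p1 n = p at hG hpos
  have hlt : (n - 1) ^ 2 < p * (2 * n - p) := by
    rw [← hG]
    unfold g
    have := Nat.mod_lt ((n - 1) ^ 2 - p) (show 0 < 2 * p by omega)
    omega
  have hle : p ≤ 2 * n := by
    by_contra hc
    have h0 : 2 * n - p = 0 := by omega
    rw [h0] at hlt
    omega
  have hR : ((n : ℝ) - 1) ^ 2 < p * (2 * n - p) := by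
    have h : (((n - 1) ^ 2 : ℕ) : ℝ) < ((p * (2 * n - p) : ℕ) : ℝ) := by exact_mod_cast hlt
    rw [Nat.cast_pow, Nat.cast_mul, Nat.cast_sub hle, Nat.cast_sub (by omega : 1 ≤ n)] at h
    push_cast at h
    exact h
  have : (n : ℝ) - p < Real.sqrt (2 * n - 1) := by
    apply Real.lt_sqrt_of_sq_lt
    nlinarith
  linarith
end

section
/- If n > 7 is an integer and 2n is a G number, then p1(n) is the smallest prime factor of g((n-1)^2, p1(n)). -/
theorem g_spec (x m : ℕ) (hm : 0 < m) (hx : m ≤ x) :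
    ∃ t, g x m = m * (2 * t + 1) ∧ x < g x m ∧ g x m ≤ x + 2 * m := by
  have h1 := Nat.div_add_mod (x - m) (2 * m)
  have h2 := Nat.mod_lt (x - m) (show 0 < 2 * m by omega)
  refine ⟨(x - m) / (2 * m) + 1, ?_, ?_, ?_⟩
  · have h3 : m * (2 * ((x - m) / (2 * m) + 1) + 1)
        = 2 * m * ((x - m) / (2 * m)) + 3 * m := by ring
    rw [h3]; unfold g; omega
  · unfold g; omega
  · unfold g; omega

theorem g_min (x m k : ℕ) (hm : 0 < m) (hx : m ≤ x) (hk : Odd k) (h : x < m * k) :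
    g x m ≤ m * k := by
  obtain ⟨t, h1, h2, h3⟩ := g_spec x m hm hx
  obtain ⟨s, rfl⟩ := hk
  rw [h1] at h3 ⊢
  by_contra hc
  have hst : 2 * s + 1 < 2 * t + 1 := lt_of_mul_lt_mul_left (not_le.mp hc) (Nat.zero_le m)
  have h4 : m * (2 * s + 1 + 2) ≤ m * (2 * t + 1) := Nat.mul_le_mul_left m (by omega)
  nlinarith

theorem stmt_4 (n : ℕ) (hn : 7 < n) (hG : IsGNumber n) :
    p1 n = Nat.minFac (g ((n - 1) ^ 2) (p1 n)) := by
  have hne : ((Finset.range (n + 1)).filter (fun p => p.Prime ∧ Odd p)).Nonempty :=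
    ⟨3, by simp only [Finset.mem_filter, Finset.mem_range]
           exact ⟨by omega, by norm_num, by decide⟩⟩
  obtain ⟨p, hp, hpe⟩ := Finset.exists_mem_eq_sup _ hne
    (fun p => Nat.minFac (g ((n - 1) ^ 2) p))
  change p1 n = Nat.minFac (g ((n - 1) ^ 2) p) at hpe
  unfold IsGNumber at hG
  simp only [Finset.mem_filter, Finset.mem_range] at hp
  obtain ⟨hpn, hpp, hpo⟩ := hp
  generalize p1 n = q at *
  obtain ⟨m, rfl⟩ : ∃ m, n = m + 1 := ⟨n - 1, by omega⟩
  simp only [Nat.add_sub_cancel] at *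
  have hxm : m + 1 ≤ m ^ 2 := by nlinarith
  obtain ⟨t, h1, h2, h3⟩ := g_spec (m ^ 2) p hpp.pos (by omega)
  have hN1 : g (m ^ 2) p ≠ 1 := by omega
  have hq : q.Prime := hpe ▸ Nat.minFac_prime hN1
  have hqd : q ∣ g (m ^ 2) p := hpe ▸ Nat.minFac_dvd _
  have hqp : q ≤ p := hpe ▸ Nat.minFac_le_of_dvd hpp.two_le ⟨_, h1⟩
  by_cases hpq : q = p
  · rw [← hpq] at hpe; exact hpe
  exfalso
  obtain ⟨j, hj⟩ : q ∣ 2 * t + 1 := by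
    rw [h1] at hqd
    rcases hq.dvd_mul.mp hqd with h | h
    · exact absurd ((Nat.prime_dvd_prime_iff_eq hq hpp).mp h) hpq
    · exact h
  obtain ⟨_, -, h5, -⟩ := g_spec (m ^ 2) q hq.pos (by omega)
  obtain ⟨d, hd⟩ : ∃ d, m + 1 = q + d := ⟨m + 1 - q, by omega⟩
  have hsub : 2 * (m + 1) - q = q + 2 * d := by omega
  rw [hG, hsub] at h5
  have hdd : d ^ 2 < 2 * m + 1 := by
    have : (m + 1) ^ 2 = (q + d) ^ 2 := by rw [hd]
    nlinarith
  have hdq : d + 1 ≤ q := by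
    by_contra hc
    have : d ≤ 3 := by nlinarith
    omega
  have hq4 : 4 ≤ q := by
    by_contra hc
    omega
  by_cases hj1 : j = 1
  · subst hj1
    have hN : g (m ^ 2) p = q * p := by rw [h1, hj]; ring
    have h6 := g_min (m ^ 2) q p hq.pos (by omega) hpo (by omega)
    rw [hG, hsub] at h6
    have := Nat.le_of_mul_le_mul_left h6 hq.pos
    omega
  · have hj0 : j ≠ 0 := by rintro rfl; simp at hj
    have hqj : q ≤ j := by
      have h7 : j.minFac ∣ g (m ^ 2) p := by
        rw [h1, hj]
        exact (Nat.minFac_dvd j).trans ⟨p * q, by ring⟩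
      have := Nat.minFac_le_of_dvd (Nat.minFac_prime hj1).two_le h7
      have := Nat.minFac_le (Nat.pos_of_ne_zero hj0)
      omega
    have h8 : q * (q * q) ≤ p * (2 * t + 1) := by
      rw [hj]; gcongr
    have h9 : 4 * (q * q) ≤ q * (q * q) := by gcongr
    have h10 : m + 2 ≤ 2 * q := by omega
    rw [← h1] at h8
    nlinarith
end

section
/- If n > 7 is an integer and 2n is a G number, then k1 = g((n-1)^2, p1(n)) / p1(n) is a prime number. -/
theorem g_spec_aux (x m : ℕ) (hm : 0 < m) (hx : m ≤ x) :
    ∃ k, g x m = m * (2 * k + 1) ∧ x < g x m ∧ g x m ≤ x + 2 * m := by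
  have h1 := Nat.div_add_mod (x - m) (2 * m)
  have h2 := Nat.mod_lt (x - m) (show 0 < 2 * m by omega)
  refine ⟨(x - m) / (2 * m) + 1, ?_, ?_, ?_⟩
  · unfold g
    have : m * (2 * ((x - m) / (2 * m) + 1) + 1) =
      2 * m * ((x - m) / (2 * m)) + 3 * m := by ring
    rw [this]; omega
  · unfold g; omega
  · unfold g; omega

theorem arith_aux (n P d x : ℕ) (h1 : d + P = 2 * n) (h2 : x < P * d)
    (h3 : x + 2 * n = n ^ 2 + 1) (h4 : 7 < n) (h5 : 2 * P ≤ n) : False := by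
  obtain ⟨t, rfl⟩ := Nat.exists_eq_add_of_le h5
  obtain rfl : d = 3 * P + 2 * t := by omega
  have h6 : 8 * (2 * P + t) ≤ (2 * P + t) * (2 * P + t) := Nat.mul_le_mul_right _ h4
  have h7 : 0 ≤ P * t := Nat.zero_le _
  have h8 : 0 ≤ t * t := Nat.zero_le _
  nlinarith only [h2, h3, h6, h7, h8]

theorem stmt_5 (n : ℕ) (hn : 7 < n) (hG : IsGNumber n) :
    Nat.Prime (g ((n - 1) ^ 2) (p1 n) / p1 n) := by
  unfold IsGNumber at hG
  have hne : ((Finset.range (n + 1)).filter (fun p => p.Prime ∧ Odd p)).Nonempty := by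
    refine ⟨3, ?_⟩
    simp only [Finset.mem_filter, Finset.mem_range]
    exact ⟨by omega, by norm_num, by decide⟩
  obtain ⟨p, hp, hpe⟩ := Finset.exists_mem_eq_sup _ hne
    (fun p => Nat.minFac (g ((n - 1) ^ 2) p))
  change p1 n = _ at hpe
  simp only [Finset.mem_filter, Finset.mem_range] at hp
  obtain ⟨hpn, hpp, hpo⟩ := hp
  have hxn : n ≤ (n - 1) ^ 2 := by
    obtain ⟨m, rfl⟩ : ∃ m, n = m + 1 := ⟨n - 1, by omega⟩
    simp only [Nat.add_sub_cancel]
    nlinarith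
  have hx2 : (n - 1) ^ 2 + 2 * n = n ^ 2 + 1 := by
    obtain ⟨m, rfl⟩ : ∃ m, n = m + 1 := ⟨n - 1, by omega⟩
    simp only [Nat.add_sub_cancel]
    ring
  generalize p1 n = P at *
  generalize (n - 1) ^ 2 = x at *
  obtain ⟨k, hk, hk1, hk2⟩ := g_spec_aux x p hpp.pos (by omega)
  have hPp : P ≤ p := by
    rw [hpe]
    exact Nat.minFac_le_of_dvd hpp.two_le ⟨_, hk⟩
  have hy1 : g x p ≠ 1 := by omega
  have hPpr : P.Prime := by rw [hpe]; exact Nat.minFac_prime hy1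
  have hPd : P ∣ g x p := by rw [hpe]; exact Nat.minFac_dvd _
  obtain ⟨l, hl, hl1, hl2⟩ := g_spec_aux x P hPpr.pos (by omega)
  have hkey : ∀ q, q.Prime → q ∣ g x p → P ≤ q := by
    intro q hq hd
    rw [hpe]
    exact Nat.minFac_le_of_dvd hq.two_le hd
  obtain ⟨d, hd⟩ : ∃ d, 2 * n - P = d := ⟨_, rfl⟩
  have hdP : d + P = 2 * n := by omega
  rw [hd] at hG
  rw [hG, Nat.mul_div_cancel_left _ hPpr.pos]
  rw [hG] at hl1
  have h2P : n + 1 ≤ 2 * P := by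
    by_contra hcon
    exact arith_aux n P d x hdP hl1 hx2 hn (by omega)
  by_cases hpP : p = P
  · subst hpP
    by_contra hnp
    have hq : (Nat.minFac d).Prime := Nat.minFac_prime (by omega)
    have h3 : p ≤ Nat.minFac d := by
      apply hkey _ hq
      rw [hG]
      exact (Nat.minFac_dvd d).trans (Dvd.intro_left _ rfl)
    have h4 := Nat.minFac_sq_le_self (by omega : 0 < d) hnp
    nlinarith
  · have hco : P ∣ 2 * k + 1 := by
      rw [hk] at hPd
      rcases (Nat.Prime.dvd_mul hPpr).1 hPd with h | h
      · exact absurd ((Nat.prime_dvd_prime_iff_eq hPpr hpp).1 h).symm hpP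
      · exact h
    obtain ⟨m, hm⟩ := hco
    have hmo : Odd (P * m) := by rw [← hm]; exact ⟨k, rfl⟩
    have hm1 : m = 1 := by
      by_contra hne1
      have hq := Nat.minFac_prime hne1
      have h3 : P ≤ Nat.minFac m := by
        apply hkey _ hq
        rw [hk, hm]
        exact ((Nat.minFac_dvd m).trans (Dvd.intro_left _ rfl)).trans (Dvd.intro_left _ rfl)
      have hm0 : 0 < m := by
        rcases Nat.eq_zero_or_pos m with h | h
        · subst h; simp at hm
        · exact h
      have h4 : P ≤ m := h3.trans (Nat.minFac_le hm0)
      have h5 : p * (P * m) ≤ n ^ 2 + 1 := by rw [← hm, ← hk]; omega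
      have h6 : P * (P * P) ≤ p * (P * m) := by gcongr
      have h7 : n ^ 2 ≤ (2 * P - 1) ^ 2 := Nat.pow_le_pow_left (by omega) 2
      obtain ⟨r, rfl⟩ : ∃ r, P = r + 5 := ⟨P - 5, by omega⟩
      have h8 : 2 * (r + 5) - 1 = 2 * r + 9 := by omega
      rw [h8] at h7
      nlinarith [Nat.zero_le (r ^ 3), Nat.zero_le (r ^ 2)]
    subst hm1
    rw [hm, mul_one] at hk
    -- minimality of g x P among odd multiples of P above x
    have h9 : d ≤ p := by
      by_contra hlt
      have hdl : d = 2 * l + 1 := by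
        rw [hG] at hl
        exact Nat.eq_of_mul_eq_mul_left hPpr.pos hl
      obtain ⟨s, hs⟩ := hpo
      have h10 : p + 2 ≤ d := by omega
      have h11 : P * (p + 2) ≤ P * d := Nat.mul_le_mul_left _ h10
      rw [hG] at hl2
      rw [hk] at hk1
      nlinarith
    have : d = p := by omega
    rw [this]; exact hpp
end

section
/- There are infinitely many G numbers; that is, for every integer N there exists an integer n > 2 with 2n > N such that 2n is a G number. -/
theorem g_self_aux (k : ℕ) : g ((k + 3 - 1) ^ 2) (k + 3) = (k + 3) ^ 2 ∨ Even (k + 3) := by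
  rcases Nat.even_or_odd (k + 3) with h | h
  · exact Or.inr h
  · left
    obtain ⟨j, hj⟩ := h
    obtain ⟨i, rfl⟩ : ∃ i, j = i + 1 := ⟨j - 1, by omega⟩
    obtain rfl : k = 2 * i := by omega
    unfold g
    have e : (2 * i + 3 - 1) ^ 2 - (2 * i + 3) = 1 + 2 * (2 * i + 3) * i := by
      have : (2 * i + 3 - 1) = 2 * i + 2 := by omega
      rw [this]
      apply Nat.sub_eq_of_eq_add
      ring
    rw [e, Nat.add_mul_mod_self_left, Nat.mod_eq_of_lt (by omega)]
    have : (2 * i + 3 - 1) = 2 * i + 2 := by omega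
    rw [this]
    apply Nat.sub_eq_of_eq_add
    ring

theorem g_dvd_aux (x p : ℕ) (h : p ≤ x) : p ∣ g x p := by
  unfold g
  obtain ⟨y, rfl⟩ := Nat.exists_eq_add_of_le h
  rw [Nat.add_sub_cancel_left]
  have h1 := Nat.mod_add_div y (2 * p)
  refine ⟨3 + 2 * (y / (2 * p)), ?_⟩
  apply Nat.sub_eq_of_eq_add
  nlinarith

theorem stmt_7 : ∀ N : ℕ, ∃ n : ℕ, 2 < n ∧ N < 2 * n ∧ IsGNumber n := by
  intro N
  obtain ⟨n, hn, hp⟩ := Nat.exists_infinite_primes (N + 3)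
  refine ⟨n, by omega, by omega, ?_⟩
  have hodd : Odd n := hp.odd_of_ne_two (by omega)
  obtain ⟨k, rfl⟩ : ∃ k, n = k + 3 := ⟨n - 3, by omega⟩
  have hg : g ((k + 3 - 1) ^ 2) (k + 3) = (k + 3) ^ 2 :=
    (g_self_aux k).resolve_right (Nat.not_even_iff_odd.mpr hodd)
  have hp1 : p1 (k + 3) = k + 3 := by
    apply le_antisymm
    · apply Finset.sup_le
      intro p hpm
      simp only [Finset.mem_filter, Finset.mem_range] at hpm
      have hle : p ≤ (k + 3 - 1) ^ 2 := by
        have : k + 3 - 1 = k + 2 := by omega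
        rw [this]
        nlinarith
      exact (Nat.minFac_le_of_dvd hpm.2.1.two_le (g_dvd_aux _ p hle)).trans (by omega)
    · have := Finset.le_sup (f := fun p => Nat.minFac (g ((k + 3 - 1) ^ 2) p))
        (s := (Finset.range (k + 3 + 1)).filter (fun p => p.Prime ∧ Odd p)) (b := k + 3)
        (by simp only [Finset.mem_filter, Finset.mem_range]; exact ⟨by omega, hp, hodd⟩)
      simp only [hg, hp.pow_minFac (two_ne_zero)] at this
      exact this
  unfold IsGNumber
  rw [hp1, hg]
  have : 2 * (k + 3) - (k + 3) = k + 3 := by omega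
  rw [this, sq]
end

section
/- If n > 2 is a prime number, then 2n is a G number. -/
theorem g_aux (x m : ℕ) (h : m ≤ x) : m ∣ g x m := by
  unfold g
  have h1 := Nat.mod_add_div (x - m) (2 * m)
  refine ⟨3 + 2 * ((x - m) / (2 * m)), ?_⟩
  have h2 : m * (3 + 2 * ((x - m) / (2 * m))) = 3 * m + 2 * m * ((x - m) / (2 * m)) := by ring
  rw [h2]
  generalize 2 * m * ((x - m) / (2 * m)) = a at *
  omega

theorem g_self (n : ℕ) (hn : 2 < n) (ho : Odd n) : g ((n - 1) ^ 2) n = n ^ 2 := by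
  obtain ⟨k, rfl⟩ := ho
  obtain ⟨j, rfl⟩ : ∃ j, k = j + 1 := ⟨k - 1, by omega⟩
  unfold g
  have h1 : (2 * (j + 1) + 1 - 1) ^ 2 - (2 * (j + 1) + 1) = 1 + 2 * (2 * (j + 1) + 1) * j := by
    apply Nat.sub_eq_of_eq_add
    rw [Nat.add_sub_cancel]
    ring
  rw [h1, Nat.add_mul_mod_self_left, Nat.mod_eq_of_lt (by omega)]
  apply Nat.sub_eq_of_eq_add
  rw [Nat.add_sub_cancel]
  ring

theorem p1_prime (n : ℕ) (hn : 2 < n) (hp : Nat.Prime n) : p1 n = n := by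
  have ho : Odd n := hp.odd_of_ne_two (by omega)
  unfold p1
  apply le_antisymm
  · apply Finset.sup_le
    intro p h
    simp only [Finset.mem_filter, Finset.mem_range] at h
    obtain ⟨hlt, hpp, -⟩ := h
    have hle : p ≤ (n - 1) ^ 2 := by
      obtain ⟨j, rfl⟩ : ∃ j, n = j + 3 := ⟨n - 3, by omega⟩
      have : j + 3 - 1 = j + 2 := by omega
      rw [this]
      nlinarith
    have := Nat.minFac_le_of_dvd hpp.two_le (g_aux _ p hle)
    omega
  · have hm : n ∈ (Finset.range (n + 1)).filter (fun p => p.Prime ∧ Odd p) := by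
      simp [hp, ho]
    refine le_trans (le_of_eq ?_)
      (Finset.le_sup (f := fun p => Nat.minFac (g ((n - 1) ^ 2) p)) hm)
    simp only [g_self n hn ho]
    rw [hp.pow_minFac (by norm_num)]

theorem stmt_8 (n : ℕ) (hn : 2 < n) (hp : Nat.Prime n) : IsGNumber n := by
  unfold IsGNumber
  rw [p1_prime n hn hp, g_self n hn (hp.odd_of_ne_two (by omega))]
  have : 2 * n - n = n := by omega
  rw [this, sq]
end
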